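/- Let a be a real number with a ≠ −1/6 such that −1/2 − 2a is not a nonpositive integer and neither 1/3 − 2a, 2/3 − 2a, nor −1 − 6a is a nonpositive integer. Then ₂F₁(a, a+1/2; −1/2−2a | −1/3) = (6^{−2a}/3) · { Γ(1/3−2a)/Γ(1/3) + ((1+3a)/(1+6a)) · Γ(2/3−2a)/Γ(2/3) } · Γ(−1−4a)/Γ(−1−6a). -/

import Mathlib

open Polynomial Real Filter Topology Metric

theorem prod_range_three_mul (f : ℕ → ℝ) (n : ℕ) :
    ∏ j ∈ Finset.range (3 * n), f j =
      ∏ j ∈ Finset.range n, (f (3 * j) * f (3 * j + 1) * f (3 * j + 2)) := by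
  induction n with
  | zero => simp
  | succ n ih =>
    rw [Finset.prod_range_succ, ← ih, mul_add, mul_one, Finset.prod_range_succ,
      Finset.prod_range_succ, Finset.prod_range_succ]
    ring

/-- The factor relating a triple product of `Real.GammaSeq` to `Real.GammaSeq` at `3 * s`. -/
noncomputable def tripleGammaSeqFactor (n : ℕ) : ℝ :=
  n * (n.factorial : ℝ) ^ 3 * 3 ^ (3 * (n + 1)) / (3 * n + 2).factorial

theorem GammaSeq_mul_add_third_mul_add_two_thirds (s : ℝ) {n : ℕ} (hn : n ≠ 0) :
    GammaSeq s n * GammaSeq (s + 1 / 3) n * GammaSeq (s + 2 / 3) n =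
      GammaSeq (3 * s) (3 * n + 2) * ((n : ℝ) / (3 * n + 2)) ^ (3 * s) *
        tripleGammaSeqFactor n := by
  have hn0 : (0 : ℝ) < n := by positivity
  have hprod : ∏ j ∈ Finset.range (3 * n + 2 + 1), (3 * s + (j : ℝ)) =
      3 ^ (3 * (n + 1)) * ((∏ j ∈ Finset.range (n + 1), (s + (j : ℝ))) *
        (∏ j ∈ Finset.range (n + 1), (s + 1 / 3 + (j : ℝ))) *
        (∏ j ∈ Finset.range (n + 1), (s + 2 / 3 + (j : ℝ)))) := by
    rw [show 3 * n + 2 + 1 = 3 * (n + 1) by ring, prod_range_three_mul, pow_mul,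
      ← Finset.prod_mul_distrib, ← Finset.prod_mul_distrib,
      ← Finset.card_range (n + 1), ← Finset.prod_const, Finset.card_range,
      ← Finset.prod_mul_distrib]
    refine Finset.prod_congr rfl fun j _ => ?_
    push_cast
    ring
  have hfac : ((3 * n + 2).factorial : ℝ) ≠ 0 := by positivity
  have hm : (0 : ℝ) < 3 * n + 2 := by positivity
  have hp : ((3 : ℝ) * n + 2) ^ (3 * s) ≠ 0 := (rpow_pos_of_pos hm _).ne'
  have hpow : (n : ℝ) ^ s * (n : ℝ) ^ (s + 1 / 3) * (n : ℝ) ^ (s + 2 / 3) =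
      (n : ℝ) ^ (3 * s) * n := by
    rw [← rpow_add hn0, ← rpow_add hn0, ← rpow_add_one hn0.ne']
    ring_nf
  simp only [GammaSeq, tripleGammaSeqFactor]
  rw [hprod, div_rpow hn0.le hm.le]
  push_cast
  set P := (∏ j ∈ Finset.range (n + 1), (s + (j : ℝ)))
  set Q := (∏ j ∈ Finset.range (n + 1), (s + 1 / 3 + (j : ℝ)))
  set R := (∏ j ∈ Finset.range (n + 1), (s + 2 / 3 + (j : ℝ)))
  calc _ = ((n : ℝ) ^ s * (n : ℝ) ^ (s + 1 / 3) * (n : ℝ) ^ (s + 2 / 3)) *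
        (n.factorial : ℝ) ^ 3 * (P * Q * R)⁻¹ := by
        simp only [div_eq_mul_inv, mul_inv]; ring
    _ = _ := by
        rw [hpow]
        simp only [div_eq_mul_inv, mul_inv]
        field_simp

theorem tendsto_natCast_div_three_mul_add_two :
    Tendsto (fun n : ℕ => (n : ℝ) / (3 * n + 2)) atTop (𝓝 (1 / 3)) := by
  have h : Tendsto (fun n : ℕ => 1 / (3 + 2 / (n : ℝ))) atTop (𝓝 (1 / (3 + 0))) :=
    tendsto_const_nhds.div (tendsto_const_nhds.add (tendsto_const_div_atTop_nhds_zero_nat 2))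
      (by norm_num)
  rw [add_zero] at h
  refine h.congr' ?_
  filter_upwards [eventually_ne_atTop 0] with n hn
  have : (n : ℝ) ≠ 0 := by exact_mod_cast hn
  field_simp

theorem tendsto_GammaSeq_three_mul_add_two (s : ℝ) :
    Tendsto (fun n : ℕ => GammaSeq s (3 * n + 2)) atTop (𝓝 (Gamma s)) :=
  (GammaSeq_tendsto_Gamma s).comp
    (tendsto_atTop_mono (fun n => by simp only [id]; omega) tendsto_id)

theorem tendsto_GammaSeq_triple (s : ℝ) :
    Tendsto (fun n : ℕ => GammaSeq (3 * s) (3 * n + 2) * ((n : ℝ) / (3 * n + 2)) ^ (3 * s) *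
        tripleGammaSeqFactor n) atTop
      (𝓝 (Gamma s * Gamma (s + 1 / 3) * Gamma (s + 2 / 3))) := by
  refine (((GammaSeq_tendsto_Gamma s).mul (GammaSeq_tendsto_Gamma (s + 1 / 3))).mul
    (GammaSeq_tendsto_Gamma (s + 2 / 3))).congr' ?_
  filter_upwards [eventually_ne_atTop 0] with n hn
  exact GammaSeq_mul_add_third_mul_add_two_thirds s hn

theorem tendsto_tripleGammaSeqFactor :
    Tendsto tripleGammaSeqFactor atTop (𝓝 (3 * (Gamma (1 / 3) * Gamma (2 / 3)))) := by
  have h := tendsto_GammaSeq_triple (1 / 3)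
  have h1 : Tendsto (fun n : ℕ => GammaSeq 1 (3 * n + 2) * ((n : ℝ) / (3 * n + 2))) atTop
      (𝓝 (1 * (1 / 3))) := by
    have := (tendsto_GammaSeq_three_mul_add_two 1).mul tendsto_natCast_div_three_mul_add_two
    rwa [Gamma_one] at this
  norm_num at h
  have h2 := h.div h1 (by norm_num)
  have e : Gamma (1 / 3) * Gamma (2 / 3) / (1 * (1 / 3)) =
    3 * (Gamma (1 / 3) * Gamma (2 / 3)) := by ring
  rw [e] at h2
  refine h2.congr' ?_
  have hne := h1.eventually_ne (by norm_num : (1 : ℝ) * (1 / 3) ≠ 0)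
  filter_upwards [hne] with n hn
  simp only [Pi.div_apply]
  rw [mul_div_cancel_left₀ _ hn]

/-- The multiplication formula for the Gamma function with three factors. -/
theorem Gamma_mul_Gamma_add_third_mul_Gamma_add_two_thirds (s : ℝ) :
    Gamma s * Gamma (s + 1 / 3) * Gamma (s + 2 / 3) =
      Gamma (3 * s) * (1 / 3) ^ (3 * s) * (3 * (Gamma (1 / 3) * Gamma (2 / 3))) :=
  tendsto_nhds_unique (tendsto_GammaSeq_triple s)
    (((tendsto_GammaSeq_three_mul_add_two (3 * s)).mul
      (tendsto_natCast_div_three_mul_add_two.rpow_const (Or.inl (by norm_num)))).mul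
      tendsto_tripleGammaSeqFactor)

theorem Ring.succ_mul_choose_succ (s : ℂ) (n : ℕ) :
    ((n : ℂ) + 1) * Ring.choose s (n + 1) = (s - n) * Ring.choose s n := by
  have hn : (n.factorial : ℂ) ≠ 0 := by exact_mod_cast n.factorial_ne_zero
  have hn1 : (n : ℂ) + 1 ≠ 0 := by exact_mod_cast n.succ_ne_zero
  rw [Ring.choose_eq_smul, Ring.choose_eq_smul, descPochhammer_succ_right,
    Polynomial.smeval_mul, Polynomial.smeval_sub, Polynomial.smeval_X, pow_one,
    Polynomial.smeval_natCast, Nat.factorial_succ]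
  push_cast
  simp only [smul_eq_mul, pow_zero, nsmul_eq_mul, mul_one]
  field_simp

theorem choose_two_mul_mul_Gamma (s : ℂ) (k : ℕ) :
    Ring.choose s (2 * k) * Complex.Gamma (k + 1 / 2) =
      Complex.Gamma (1 / 2) * ((ascPochhammer ℂ k).eval (-s / 2) *
        (ascPochhammer ℂ k).eval (-s / 2 + 1 / 2) / k.factorial) := by
  induction k with
  | zero => simp
  | succ k ih =>
    have hk : (k : ℂ) + 1 ≠ 0 := by exact_mod_cast k.succ_ne_zero
    have hk2 : (2 : ℂ) * k + 1 ≠ 0 := by exact_mod_cast (2 * k).succ_ne_zero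
    have hkh : (k : ℂ) + 1 / 2 ≠ 0 := by
      intro h; apply hk2; linear_combination 2 * h
    have hf : (k.factorial : ℂ) ≠ 0 := by exact_mod_cast k.factorial_ne_zero
    have h1 := Ring.succ_mul_choose_succ s (2 * k)
    have h2 := Ring.succ_mul_choose_succ s (2 * k + 1)
    rw [show 2 * (k + 1) = 2 * k + 1 + 1 by ring]
    rw [show ((k + 1 : ℕ) : ℂ) + 1 / 2 = (k + 1 / 2) + 1 by push_cast; ring,
      Complex.Gamma_add_one _ hkh]
    simp only [ascPochhammer_succ_eval, Nat.factorial_succ]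
    push_cast at h1 h2 ⊢
    have hstep : Ring.choose s (2 * k + 1 + 1) =
        (s - (2 * k + 1)) * (s - 2 * k) / ((2 * k + 1 + 1) * (2 * k + 1)) *
          Ring.choose s (2 * k) := by
      have h3 : (2 : ℂ) * k + 1 + 1 ≠ 0 := by exact_mod_cast (2 * k + 1).succ_ne_zero
      field_simp
      linear_combination (2 * (k : ℂ) + 1) * h2 + (s - (2 * k + 1)) * h1
    have hfac : (s - (2 * k + 1)) * (s - 2 * k) / ((2 * (k : ℂ) + 1 + 1) * (2 * k + 1)) *
        (k + 1 / 2) = (-s / 2 + k) * (-s / 2 + 1 / 2 + k) / (k + 1) := by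
      rw [show (2 : ℂ) * k + 1 + 1 = 2 * (k + 1) by ring]
      field_simp
      ring
    calc _ = ((s - (2 * k + 1)) * (s - 2 * k) / ((2 * (k : ℂ) + 1 + 1) * (2 * k + 1)) *
          (k + 1 / 2)) * (Ring.choose s (2 * k) * Complex.Gamma (k + 1 / 2)) := by
          rw [hstep]; ring
      _ = _ := by
          rw [hfac, ih]
          field_simp

theorem integral_pow_mul_one_sub_pow_cpow (m n : ℕ) (hn : n ≠ 0) (p : ℝ) :
    ∫ t in (0 : ℝ)..1, (t : ℂ) ^ m * (1 - (t : ℂ) ^ n) ^ (p : ℂ) =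
      1 / (n : ℂ) * Complex.betaIntegral ((m + 1) / n) (p + 1) := by
  have hn0 : (0 : ℝ) < n := by positivity
  have hnC : (n : ℂ) ≠ 0 := by exact_mod_cast hn
  rw [Complex.betaIntegral, intervalIntegral.integral_of_le zero_le_one,
    intervalIntegral.integral_of_le zero_le_one]
  have hsub : Set.Ioc (0 : ℝ) 1 = Set.Ioi 0 ∩ Set.Iic 1 := by ext; simp
  rw [hsub, ← MeasureTheory.setIntegral_indicator measurableSet_Iic,
    ← MeasureTheory.setIntegral_indicator measurableSet_Iic,
    ← MeasureTheory.integral_comp_rpow_Ioi_of_pos (g := (Set.Iic (1 : ℝ)).indicator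
      fun x => (x : ℂ) ^ (((m : ℂ) + 1) / n - 1) * (1 - (x : ℂ)) ^ ((p : ℂ) + 1 - 1)) hn0,
    ← MeasureTheory.integral_const_mul]
  refine MeasureTheory.setIntegral_congr_fun measurableSet_Ioi fun t ht => ?_
  have ht : (0 : ℝ) < t := ht
  have htC : (t : ℂ) ≠ 0 := by exact_mod_cast ht.ne'
  simp only [rpow_natCast, Set.indicator_apply, Set.mem_Iic, pow_le_one_iff_of_nonneg ht.le hn]
  split_ifs
  · have e : ((t ^ n : ℝ) : ℂ) ^ (((m : ℂ) + 1) / n - 1) * (t ^ ((n : ℝ) - 1) : ℝ) = (t : ℂ) ^ m := by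
      rw [Complex.ofReal_cpow ht.le, ← Real.rpow_natCast, Complex.ofReal_cpow ht.le]
      have h1 : ((t : ℂ) ^ (((n : ℕ) : ℝ) : ℂ)) ^ (((m : ℂ) + 1) / n - 1) =
          (t : ℂ) ^ ((n : ℂ) * (((m : ℂ) + 1) / n - 1)) := by
        have := Complex.cpow_mul_ofReal_nonneg ht.le (n : ℝ) (((m : ℂ) + 1) / n - 1)
        simpa using this.symm
      rw [h1, ← Complex.cpow_add _ _ htC, ← Complex.cpow_natCast]
      congr 1
      push_cast
      field_simp
      ring
    simp only [Complex.real_smul, Complex.ofReal_mul, Complex.ofReal_natCast]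
    rw [← e]
    push_cast
    field_simp
    ring_nf
  · simp

/-- The terms of the regularized series `₂F₁(-s/2, -s/2 + 1/2; s - 1/2 | -1/3) / Γ(s - 1/2)`. -/
noncomputable def regularizedTerm (s : ℂ) (k : ℕ) : ℂ :=
  (ascPochhammer ℂ k).eval (-s / 2) * (ascPochhammer ℂ k).eval (-s / 2 + 1 / 2) / k.factorial *
    (Complex.Gamma (s - 1 / 2 + k))⁻¹ * (-1 / 3) ^ k

theorem hasSum_choose_mul_pow (s : ℂ) {x : ℂ} (hx : ‖x‖ < 1) :
    HasSum (fun n => Ring.choose s n * x ^ n) ((1 + x) ^ s) := by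
  have h := (Complex.one_add_cpow_hasFPowerSeriesOnBall_zero (a := s)).hasSum (y := x)
    (by simpa [enorm_eq_nnnorm, ← NNReal.coe_lt_coe] using hx)
  simpa [binomialSeries, FormalMultilinearSeries.coeff_ofScalars, mul_comm] using h

theorem continuous_one_sub_sq_cpow {p : ℝ} (hp : 0 < p) :
    Continuous fun u : ℝ => (1 - (u : ℂ) ^ 2) ^ (p : ℂ) := by
  have h : ∀ x : ℝ, ContinuousAt (fun u : ℝ => (1 - (u : ℂ) ^ 2) ^ (p : ℂ)) x := by
    intro x
    have := (Complex.continuousAt_ofReal_cpow_const (1 - x ^ 2) (p : ℂ) (Or.inl (by simpa))).comp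
      (f := fun u : ℝ => 1 - u ^ 2) (by fun_prop)
    simpa [Function.comp_def] using this
  exact continuous_iff_continuousAt.mpr h

theorem norm_one_sub_sq_cpow_le_one {p : ℝ} (hp : 0 < p) {u : ℝ} (hu : u ∈ Set.Icc (-1 : ℝ) 1) :
    ‖(1 - (u : ℂ) ^ 2) ^ (p : ℂ)‖ ≤ 1 := by
  have h0 : 0 ≤ 1 - u ^ 2 := by nlinarith [hu.1, hu.2]
  have : (1 - (u : ℂ) ^ 2) ^ (p : ℂ) = (((1 - u ^ 2) ^ p : ℝ) : ℂ) := by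
    rw [Complex.ofReal_cpow h0]; push_cast; rfl
  rw [this, Complex.norm_real, Real.norm_of_nonneg (by positivity)]
  exact Real.rpow_le_one h0 (by nlinarith) hp.le

theorem hasSum_integral_one_add_mul_cpow (s : ℂ) {p : ℝ} (hp : 0 < p) {z : ℂ} (hz : ‖z‖ < 1) :
    HasSum (fun n => Ring.choose s n * z ^ n *
        ∫ u in (-1 : ℝ)..1, (u : ℂ) ^ n * (1 - (u : ℂ) ^ 2) ^ (p : ℂ))
      (∫ u in (-1 : ℝ)..1, (1 + z * u) ^ s * (1 - (u : ℂ) ^ 2) ^ (p : ℂ)) := by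
  have hc := continuous_one_sub_sq_cpow hp
  have hsum : Summable fun n => ‖Ring.choose s n * z ^ n‖ := (hasSum_choose_mul_pow s hz).summable.norm
  have key := intervalIntegral.hasSum_integral_of_dominated_convergence
    (μ := MeasureTheory.volume) (a := (-1 : ℝ)) (b := 1)
    (F := fun n (u : ℝ) => Ring.choose s n * z ^ n * ((u : ℂ) ^ n * (1 - (u : ℂ) ^ 2) ^ (p : ℂ)))
    (f := fun u : ℝ => (1 + z * u) ^ s * (1 - (u : ℂ) ^ 2) ^ (p : ℂ))
    (fun n _ => ‖Ring.choose s n * z ^ n‖)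
    (fun n => (by fun_prop : Continuous fun u : ℝ => Ring.choose s n * z ^ n *
      ((u : ℂ) ^ n * (1 - (u : ℂ) ^ 2) ^ (p : ℂ))).aestronglyMeasurable)
    (fun n => ?_) (Eventually.of_forall fun _ _ => hsum) intervalIntegrable_const
    (Eventually.of_forall fun u hu => ?_)
  · simpa only [intervalIntegral.integral_const_mul] using key
  · refine Eventually.of_forall fun u hu => ?_
    rw [Set.uIoc_of_le (by norm_num)] at hu
    have hu' : u ∈ Set.Icc (-1 : ℝ) 1 := ⟨hu.1.le, hu.2⟩
    rw [norm_mul, norm_mul ((u : ℂ) ^ n), norm_pow, Complex.norm_real]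
    refine mul_le_of_le_one_right (norm_nonneg _) (mul_le_one₀ (pow_le_one₀ (norm_nonneg _) ?_)
      (norm_nonneg _) (norm_one_sub_sq_cpow_le_one hp hu'))
    exact abs_le.mpr hu'
  · rw [Set.uIoc_of_le (by norm_num)] at hu
    have hx : ‖z * u‖ < 1 := by
      rw [norm_mul, Complex.norm_real]
      exact mul_lt_one_of_nonneg_of_lt_one_left (norm_nonneg _) hz (abs_le.mpr ⟨hu.1.le, hu.2⟩)
    have := (hasSum_choose_mul_pow s hx).mul_right ((1 - (u : ℂ) ^ 2) ^ (p : ℂ))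
    refine this.congr_fun fun n => ?_
    rw [mul_pow]; ring

theorem integral_neg_one_one_eq {f : ℝ → ℂ} (hf : Continuous f) :
    ∫ u in (-1 : ℝ)..1, f u = (∫ u in (0 : ℝ)..1, f (-u)) + ∫ u in (0 : ℝ)..1, f u := by
  rw [intervalIntegral.integral_comp_neg, neg_zero]
  exact (intervalIntegral.integral_add_adjacent_intervals (hf.intervalIntegrable _ _)
    (hf.intervalIntegrable _ _)).symm

theorem integral_odd_pow_mul_one_sub_sq_cpow {p : ℝ} (hp : 0 < p) {n : ℕ} (hn : Odd n) :
    ∫ u in (-1 : ℝ)..1, (u : ℂ) ^ n * (1 - (u : ℂ) ^ 2) ^ (p : ℂ) = 0 := by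
  have hc := continuous_one_sub_sq_cpow hp
  rw [integral_neg_one_one_eq (by fun_prop)]
  simp [hn.neg_pow]

theorem integral_even_pow_mul_one_sub_sq_cpow {p : ℝ} (hp : 0 < p) (k : ℕ) :
    ∫ u in (-1 : ℝ)..1, (u : ℂ) ^ (2 * k) * (1 - (u : ℂ) ^ 2) ^ (p : ℂ) =
      Complex.Gamma (k + 1 / 2) * Complex.Gamma (p + 1) * (Complex.Gamma (p + 3 / 2 + k))⁻¹ := by
  have hc := continuous_one_sub_sq_cpow hp
  rw [integral_neg_one_one_eq (by fun_prop)]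
  have h := integral_pow_mul_one_sub_pow_cpow (2 * k) 2 two_ne_zero p
  have h1 : ((2 * k : ℕ) + 1 : ℂ) / (2 : ℕ) = k + 1 / 2 := by push_cast; ring
  rw [h1, Complex.betaIntegral_eq_Gamma_mul_div _ _
    (by simp; positivity) (by simp; positivity)] at h
  have h2 : (k : ℂ) + 1 / 2 + (p + 1) = p + 3 / 2 + k := by ring
  rw [h2] at h
  simp only [Complex.ofReal_neg, (even_two_mul k).neg_pow, even_two.neg_pow]
  rw [h]
  push_cast
  ring

theorem hasSum_regularizedTerm {p : ℝ} (hp : 0 < p) {z : ℂ} (hz : z ^ 2 = -1 / 3) :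
    HasSum (fun k => Complex.Gamma (1 / 2) * Complex.Gamma (p + 1) * regularizedTerm (p + 2) k)
      (∫ u in (-1 : ℝ)..1, (1 + z * u) ^ (p + 2 : ℂ) * (1 - (u : ℂ) ^ 2) ^ (p : ℂ)) := by
  have hz1 : ‖z‖ < 1 := by
    have : ‖z‖ ^ 2 = 1 / 3 := by rw [← norm_pow, hz]; norm_num
    nlinarith [norm_nonneg z]
  have h := hasSum_integral_one_add_mul_cpow (p + 2) hp hz1
  have hinj : Function.Injective fun k : ℕ => 2 * k := mul_right_injective₀ two_ne_zero
  rw [← hinj.hasSum_iff] at h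
  · refine h.congr_fun fun k => ?_
    simp only [Function.comp_apply]
    rw [integral_even_pow_mul_one_sub_sq_cpow hp, pow_mul, hz, regularizedTerm]
    have := choose_two_mul_mul_Gamma (p + 2) k
    rw [show (p : ℂ) + 2 - 1 / 2 + k = p + 3 / 2 + k by ring]
    linear_combination (-(Complex.Gamma (p + 1) * (Complex.Gamma (p + 3 / 2 + k))⁻¹ * (-1 / 3) ^ k)) * this
  · intro n hn
    have : Odd n := by
      rw [← Nat.not_even_iff_odd]
      rintro ⟨m, rfl⟩
      exact hn ⟨m, by simp; ring⟩
    rw [integral_odd_pow_mul_one_sub_sq_cpow hp this, mul_zero]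

/-- A primitive on the unit disc is given by radial integrals. -/
theorem sub_eq_mul_integral_of_hasDerivAt {F g : ℂ → ℂ}
    (hF : ∀ z ∈ ball (0 : ℂ) 1, HasDerivAt F (g z) z) (hc : ContinuousOn g (ball 0 1))
    {y : ℂ} (hy : y ∈ ball (0 : ℂ) 1) :
    F y - F 0 = y * ∫ t in (0 : ℝ)..1, g (t * y) := by
  have hmem : ∀ t ∈ Set.uIcc (0 : ℝ) 1, (t : ℂ) * y ∈ ball (0 : ℂ) 1 := by
    intro t ht
    rw [Set.uIcc_of_le zero_le_one] at ht
    rw [mem_ball_zero_iff] at hy ⊢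
    rw [norm_mul, Complex.norm_real, norm_of_nonneg ht.1]
    nlinarith [norm_nonneg y, ht.1, ht.2]
  have hderiv : ∀ t ∈ Set.uIcc (0 : ℝ) 1,
      HasDerivAt (fun t : ℝ => F (t * y)) (y * g (t * y)) t := by
    intro t ht
    have h1 : HasDerivAt (fun t : ℝ => (t : ℂ) * y) (1 * y) t :=
      (Complex.ofRealCLM.hasDerivAt (x := t)).mul_const y
    have := (hF _ (hmem t ht)).comp t h1
    rw [one_mul, mul_comm] at this
    exact this
  have hcont : ContinuousOn (fun t : ℝ => y * g (t * y)) (Set.uIcc 0 1) :=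
    continuousOn_const.mul (hc.comp (by fun_prop) hmem)
  have := intervalIntegral.integral_eq_sub_of_hasDerivAt hderiv hcont.intervalIntegrable
  rw [intervalIntegral.integral_const_mul] at this
  simpa using this.symm

/-- The integral of a function holomorphic in the open unit disc and continuous on the closed one
along a chord, in terms of radial integrals. -/
theorem integral_chord {g : ℂ → ℂ} (hd : DifferentiableOn ℂ g (ball 0 1))
    (hc : ContinuousOn g (closedBall 0 1)) {α β : ℂ}
    (hlt : ∀ u ∈ Set.Ioo (-1 : ℝ) 1, α + β * u ∈ ball (0 : ℂ) 1)
    (hle : ∀ u ∈ Set.Icc (-1 : ℝ) 1, α + β * u ∈ closedBall (0 : ℂ) 1) :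
    β * ∫ u in (-1 : ℝ)..1, g (α + β * u) =
      (α + β) * (∫ t in (0 : ℝ)..1, g (t * (α + β))) -
        (α - β) * ∫ t in (0 : ℝ)..1, g (t * (α - β)) := by
  obtain ⟨F, hF⟩ := hd.isExactOn_ball
  obtain ⟨M, hM⟩ := (isCompact_closedBall (0 : ℂ) 1).exists_bound_of_continuousOn hc
  have hcb : ContinuousOn g (ball 0 1) := hc.mono ball_subset_closedBall
  have hscale : ∀ t ∈ Set.uIoc (0 : ℝ) 1, ∀ y ∈ closedBall (0 : ℂ) 1,
      (t : ℂ) * y ∈ closedBall (0 : ℂ) 1 := by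
    intro t ht y hy
    rw [Set.uIoc_of_le zero_le_one] at ht
    rw [mem_closedBall_zero_iff] at hy ⊢
    rw [norm_mul, Complex.norm_real, norm_of_nonneg ht.1.le]
    nlinarith [norm_nonneg y, ht.1, ht.2]
  have hlim : ∀ u₀ ∈ Set.Icc (-1 : ℝ) 1,
      Tendsto (fun u : ℝ => F (α + β * u)) (𝓝[Set.Ioo (-1) 1] u₀)
        (𝓝 (F 0 + (α + β * u₀) * ∫ t in (0 : ℝ)..1, g (t * (α + β * u₀)))) := by
    intro u₀ hu₀
    have hline : Tendsto (fun u : ℝ => α + β * (u : ℂ)) (𝓝[Set.Ioo (-1) 1] u₀)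
        (𝓝 (α + β * u₀)) :=
      (Continuous.tendsto (by fun_prop) u₀).mono_left nhdsWithin_le_nhds
    have hint : Tendsto (fun u : ℝ => ∫ t in (0 : ℝ)..1, g (t * (α + β * u)))
        (𝓝[Set.Ioo (-1) 1] u₀) (𝓝 (∫ t in (0 : ℝ)..1, g (t * (α + β * u₀)))) := by
      refine intervalIntegral.tendsto_integral_filter_of_dominated_convergence (fun _ => M)
        ?_ ?_ intervalIntegrable_const ?_
      · filter_upwards [self_mem_nhdsWithin] with u hu
        refine ContinuousOn.aestronglyMeasurable ?_ measurableSet_uIoc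
        exact hc.comp (by fun_prop)
          fun t ht => hscale t ht _ (ball_subset_closedBall (hlt u hu))
      · filter_upwards [self_mem_nhdsWithin] with u hu
        exact Eventually.of_forall fun t ht =>
          hM _ (hscale t ht _ (ball_subset_closedBall (hlt u hu)))
      · refine Eventually.of_forall fun t ht => ?_
        refine (hc _ (hscale t ht _ (hle u₀ hu₀))).tendsto.comp ?_
        refine tendsto_nhdsWithin_iff.mpr ⟨hline.const_mul _, ?_⟩
        filter_upwards [self_mem_nhdsWithin] with u hu
        exact hscale t ht _ (ball_subset_closedBall (hlt u hu))
    refine ((hline.mul hint).const_add (F 0)).congr' ?_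
    filter_upwards [self_mem_nhdsWithin] with u hu
    rw [← sub_eq_mul_integral_of_hasDerivAt hF hcb (hlt u hu)]
    ring
  have hderiv : ∀ u ∈ Set.Ioo (-1 : ℝ) 1,
      HasDerivAt (fun u : ℝ => F (α + β * u)) (β * g (α + β * u)) u := by
    intro u hu
    have h1 : HasDerivAt (fun u : ℝ => α + β * (u : ℂ)) (β * 1) u :=
      ((Complex.ofRealCLM.hasDerivAt (x := u)).const_mul β).const_add α
    have := (hF _ (hlt u hu)).comp u h1
    rw [mul_one, mul_comm] at this
    exact this
  have hcont : ContinuousOn (fun u : ℝ => β * g (α + β * u)) (Set.uIcc (-1) 1) := by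
    rw [Set.uIcc_of_le (by norm_num)]
    exact continuousOn_const.mul (hc.comp (by fun_prop) hle)
  have hl := hlim (-1) (by norm_num)
  have hr := hlim 1 (by norm_num)
  rw [nhdsWithin_Ioo_eq_nhdsGT (by norm_num)] at hl
  rw [nhdsWithin_Ioo_eq_nhdsLT (by norm_num)] at hr
  have := intervalIntegral.integral_eq_sub_of_hasDerivAt_of_tendsto (by norm_num) hderiv
    hcont.intervalIntegrable hl hr
  rw [← intervalIntegral.integral_const_mul, this]
  push_cast
  simp only [mul_neg, mul_one, ← sub_eq_add_neg]
  ring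

theorem differentiable_regularizedTerm (k : ℕ) :
    Differentiable ℂ fun s => regularizedTerm s k := by
  have hG : Differentiable ℂ fun s : ℂ => (Complex.Gamma (s - 1 / 2 + k))⁻¹ :=
    Complex.differentiable_one_div_Gamma.comp (by fun_prop : Differentiable ℂ fun s : ℂ => s - 1 / 2 + k)
  have hp : Differentiable ℂ fun x : ℂ => (ascPochhammer ℂ k).eval x := Polynomial.differentiable _
  have h1 : Differentiable ℂ fun s : ℂ => (ascPochhammer ℂ k).eval (-s / 2) :=
    hp.comp (by fun_prop : Differentiable ℂ fun s : ℂ => -s / 2)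
  have h2 : Differentiable ℂ fun s : ℂ => (ascPochhammer ℂ k).eval (-s / 2 + 1 / 2) :=
    hp.comp (by fun_prop : Differentiable ℂ fun s : ℂ => -s / 2 + 1 / 2)
  unfold regularizedTerm
  exact ((((h1.mul h2).div_const _)).mul hG).mul_const _

theorem norm_regularizedTerm_succ_le {R : ℝ} (hR : 1 ≤ R) {s : ℂ} (hs : ‖s‖ ≤ R) {k : ℕ}
    (hk : 20 * R ≤ k) : ‖regularizedTerm s (k + 1)‖ ≤ 1 / 2 * ‖regularizedTerm s k‖ := by
  have hk0 : (0 : ℝ) < k := by linarith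
  have hlow : (k : ℝ) - 2 * R ≤ ‖s - 1 / 2 + k‖ := by
    have h1 : ‖(k : ℂ)‖ ≤ ‖s - 1 / 2 + k‖ + ‖s - 1 / 2‖ := by
      simpa using norm_sub_le (s - 1 / 2 + k) (s - 1 / 2)
    have h2 : ‖s - 1 / 2‖ ≤ ‖s‖ + ‖(1 / 2 : ℂ)‖ := norm_sub_le _ _
    have h3 : ‖(1 / 2 : ℂ)‖ = 1 / 2 := by norm_num
    rw [Complex.norm_natCast] at h1
    linarith
  have hup1 : ‖-s / 2 + k‖ ≤ k + R := by
    have h1 : ‖-s / 2 + k‖ ≤ ‖-s / 2‖ + ‖(k : ℂ)‖ := norm_add_le _ _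
    rw [Complex.norm_natCast, norm_div, norm_neg, Complex.norm_ofNat] at h1
    linarith [norm_nonneg s]
  have hup2 : ‖-s / 2 + 1 / 2 + k‖ ≤ k + R := by
    have h1 : ‖-s / 2 + 1 / 2 + k‖ ≤ ‖-s / 2‖ + ‖(1 / 2 : ℂ)‖ + ‖(k : ℂ)‖ := norm_add₃_le
    have h3 : ‖(1 / 2 : ℂ)‖ = 1 / 2 := by norm_num
    rw [Complex.norm_natCast, norm_div, norm_neg, Complex.norm_ofNat, h3] at h1
    linarith [norm_nonneg s]
  have hpos : 0 < ‖s - 1 / 2 + k‖ := by linarith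
  have hne : s - 1 / 2 + k ≠ 0 := norm_pos_iff.mp hpos
  have hrec : regularizedTerm s (k + 1) =
      ((-s / 2 + k) * (-s / 2 + 1 / 2 + k) / ((k + 1) * (s - 1 / 2 + k)) * (-1 / 3)) *
        regularizedTerm s k := by
    simp only [regularizedTerm, ascPochhammer_succ_eval, Nat.factorial_succ, pow_succ]
    push_cast
    rw [← add_assoc, Complex.Gamma_add_one _ hne]
    simp only [div_eq_mul_inv, mul_inv]
    ring
  rw [hrec, norm_mul]
  refine mul_le_mul_of_nonneg_right ?_ (norm_nonneg _)
  rw [norm_mul, norm_div, norm_mul, norm_mul]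
  have h3 : ‖(-1 / 3 : ℂ)‖ = 1 / 3 := by norm_num
  have h4 : ‖(k : ℂ) + 1‖ = k + 1 := by exact_mod_cast Complex.norm_natCast (k + 1)
  rw [h3, h4]
  have hden : (k : ℝ) * (k - 2 * R) ≤ (k + 1) * ‖s - 1 / 2 + k‖ := by
    gcongr <;> linarith
  have hnum : ‖-s / 2 + k‖ * ‖-s / 2 + 1 / 2 + k‖ ≤ (k + R) * (k + R) := by gcongr
  have : ‖-s / 2 + k‖ * ‖-s / 2 + 1 / 2 + k‖ / ((k + 1) * ‖s - 1 / 2 + k‖) ≤ 3 / 2 := by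
    rw [div_le_iff₀ (by positivity)]
    nlinarith
  linarith

theorem differentiable_tsum_regularizedTerm :
    Differentiable ℂ fun s => ∑' k, regularizedTerm s k := by
  intro s₀
  set R : ℝ := ‖s₀‖ + 1
  have hR : 1 ≤ R := by simp [R]
  obtain ⟨K, hK⟩ := exists_nat_ge (20 * R)
  have hbound : ∀ k, ∃ C, ∀ s ∈ closedBall (0 : ℂ) R, ‖regularizedTerm s k‖ ≤ C := fun k =>
    (isCompact_closedBall (0 : ℂ) R).exists_bound_of_continuousOn
      (differentiable_regularizedTerm k).continuous.continuousOn
  choose C hC using hbound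
  have hgeom : ∀ s ∈ closedBall (0 : ℂ) R, ∀ k,
      ‖regularizedTerm s (k + K)‖ ≤ C K * (1 / 2) ^ k := by
    intro s hs k
    induction k with
    | zero => simpa using hC K s hs
    | succ k ih =>
      have hk : 20 * R ≤ ((k + K : ℕ) : ℝ) := by
        push_cast; linarith [(Nat.cast_nonneg k : (0 : ℝ) ≤ k)]
      have := norm_regularizedTerm_succ_le hR (mem_closedBall_zero_iff.mp hs) hk
      rw [show k + 1 + K = k + K + 1 by ring, pow_succ]
      linarith
  let u : ℕ → ℝ := fun k => if k < K then C k else C K * (1 / 2) ^ (k - K)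
  have hu : Summable u := by
    rw [← summable_nat_add_iff K]
    simpa [u] using summable_geometric_two.mul_left (C K)
  have hd : DifferentiableOn ℂ (fun s => ∑' k, regularizedTerm s k) (ball 0 R) := by
    refine Complex.differentiableOn_tsum_of_summable_norm hu
      (fun k => (differentiable_regularizedTerm k).differentiableOn) isOpen_ball fun k s hs => ?_
    have hs' := ball_subset_closedBall hs
    by_cases hk : k < K
    · simpa [u, hk] using hC k s hs'
    · obtain ⟨j, rfl⟩ := Nat.exists_eq_add_of_le' (not_lt.mp hk)
      simpa [u] using hgeom s hs' j
  exact hd.differentiableAt (isOpen_ball.mem_nhds (by simp [R]))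

theorem ofReal_mul_cpow {r : ℝ} (hr : 0 ≤ r) (x : ℂ) {p : ℂ} (hp : p ≠ 0) :
    (r * x) ^ p = (r : ℂ) ^ p * x ^ p := by
  rcases hr.eq_or_lt with rfl | hr
  · simp [Complex.zero_cpow hp]
  by_cases hx : x = 0
  · simp [hx, Complex.zero_cpow hp]
  have hr' : (r : ℂ) ≠ 0 := by exact_mod_cast hr.ne'
  rw [Complex.cpow_def_of_ne_zero (mul_ne_zero hr' hx), Complex.cpow_def_of_ne_zero hr',
    Complex.cpow_def_of_ne_zero hx, Complex.log_ofReal_mul hr hx, ← Complex.ofReal_log hr.le,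
    ← Complex.exp_add, add_mul]

/-- The integrand `(1 - y)² (1 - y³)ᵖ`, holomorphic in the unit disc. -/
noncomputable def discIntegrand (p y : ℂ) : ℂ := (1 - y) ^ 2 * (1 - y ^ 3) ^ p

theorem differentiableOn_discIntegrand (p : ℂ) :
    DifferentiableOn ℂ (discIntegrand p) (ball 0 1) := by
  intro y hy
  have hy1 : ‖y‖ < 1 := by simpa using hy
  have h3 : ‖y ^ 3‖ < 1 := by
    rw [norm_pow]; exact pow_lt_one₀ (norm_nonneg _) hy1 three_ne_zero
  have hs : 1 - y ^ 3 ∈ Complex.slitPlane := by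
    left
    have := (Complex.re_le_norm (y ^ 3)).trans_lt h3
    simp only [Complex.sub_re, Complex.one_re]
    linarith
  unfold discIntegrand
  have hd : DifferentiableAt ℂ (fun y : ℂ => 1 - y ^ 3) y := by fun_prop
  exact (DifferentiableAt.mul (by fun_prop) (hd.cpow_const hs)).differentiableWithinAt

theorem continuousOn_discIntegrand {p : ℂ} (hp : 0 < p.re) :
    ContinuousOn (discIntegrand p) (closedBall 0 1) := by
  intro y hy
  have hy1 : ‖y‖ ≤ 1 := by simpa using hy
  have h3 : ‖y ^ 3‖ ≤ 1 := by
    rw [norm_pow]; exact pow_le_one₀ (norm_nonneg _) hy1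
  have hs : 0 ≤ (1 - y ^ 3).re := by
    have := (Complex.re_le_norm (y ^ 3)).trans h3
    simp only [Complex.sub_re, Complex.one_re]
    linarith
  have hc : ContinuousAt (fun y : ℂ => (1 - y ^ 3) ^ p) y :=
    (Complex.continuousAt_cpow_const_of_re_pos (Or.inl hs) hp).comp
      (f := fun y : ℂ => 1 - y ^ 3) (by fun_prop)
  unfold discIntegrand
  exact (ContinuousAt.mul (by fun_prop) hc).continuousWithinAt

theorem mul_integral_discIntegrand {p : ℝ} (hp : 0 < p) {y : ℂ} (hy : y ^ 3 = 1) :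
    y * ∫ t in (0 : ℝ)..1, discIntegrand p (t * y) =
      y * (∫ t in (0 : ℝ)..1, (t : ℂ) ^ 0 * (1 - (t : ℂ) ^ 3) ^ (p : ℂ)) -
        2 * y ^ 2 * (∫ t in (0 : ℝ)..1, (t : ℂ) ^ 1 * (1 - (t : ℂ) ^ 3) ^ (p : ℂ)) +
        ∫ t in (0 : ℝ)..1, (t : ℂ) ^ 2 * (1 - (t : ℂ) ^ 3) ^ (p : ℂ) := by
  have hc : Continuous fun t : ℝ => (1 - (t : ℂ) ^ 3) ^ (p : ℂ) := by
    refine continuous_iff_continuousAt.mpr fun x => ?_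
    have := (Complex.continuousAt_ofReal_cpow_const (1 - x ^ 3) (p : ℂ) (Or.inl (by simpa))).comp
      (f := fun t : ℝ => 1 - t ^ 3) (by fun_prop)
    simpa [Function.comp_def] using this
  have hi : ∀ (c : ℂ) (m : ℕ), IntervalIntegrable
      (fun t : ℝ => c * ((t : ℂ) ^ m * (1 - (t : ℂ) ^ 3) ^ (p : ℂ))) MeasureTheory.volume 0 1 :=
    fun c m => (by fun_prop : Continuous _).intervalIntegrable _ _
  have hi' : ∀ m : ℕ, IntervalIntegrable
      (fun t : ℝ => (t : ℂ) ^ m * (1 - (t : ℂ) ^ 3) ^ (p : ℂ)) MeasureTheory.volume 0 1 :=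
    fun m => by simpa using hi 1 m
  rw [← intervalIntegral.integral_const_mul, ← intervalIntegral.integral_const_mul,
    ← intervalIntegral.integral_const_mul, ← intervalIntegral.integral_sub (hi _ _) (hi _ _),
    ← intervalIntegral.integral_add ((hi _ _).sub (hi _ _)) (hi' _)]
  refine intervalIntegral.integral_congr fun t _ => ?_
  simp only [discIntegrand, mul_pow, hy, mul_one]
  linear_combination ((t : ℂ) ^ 2 * (1 - (t : ℂ) ^ 3) ^ (p : ℂ)) * hy

theorem integral_discIntegrand_chord {p : ℝ} (hp : 0 < p) {β : ℂ} (hβ : β ^ 2 = -3 / 4) :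
    ∫ u in (-1 : ℝ)..1, discIntegrand p (-1 / 2 + β * u) =
      2 / 3 * Complex.Gamma (p + 1) * (Complex.Gamma (1 / 3) * (Complex.Gamma (p + 4 / 3))⁻¹ +
        2 * Complex.Gamma (2 / 3) * (Complex.Gamma (p + 5 / 3))⁻¹) := by
  have hβ0 : β ≠ 0 := by rintro rfl; norm_num at hβ
  have hre : β.re = 0 ∧ β.im ^ 2 = 3 / 4 := by
    have h1 := congrArg Complex.re hβ
    have h2 := congrArg Complex.im hβ
    rw [pow_two] at h1 h2
    norm_num [Complex.mul_re, Complex.mul_im] at h1 h2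
    have h3 : β.re * β.im = 0 := by linarith
    rcases mul_eq_zero.mp h3 with h | h
    · exact ⟨h, by rw [h] at h1; linarith⟩
    · rw [h] at h1; nlinarith [sq_nonneg β.re]
  have hnorm : ∀ u : ℝ, ‖(-1 / 2 + β * u : ℂ)‖ ^ 2 = 1 / 4 + 3 / 4 * u ^ 2 := by
    intro u
    rw [← Complex.normSq_eq_norm_sq, Complex.normSq_apply]
    simp [hre.1]
    linear_combination u ^ 2 * hre.2
  have hchord := integral_chord (differentiableOn_discIntegrand (p : ℂ))
    (continuousOn_discIntegrand (p := (p : ℂ)) (by simpa)) (α := -1 / 2) (β := β)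
    (fun u hu => by
      rw [mem_ball_zero_iff]
      nlinarith [hnorm u, hu.1, hu.2, norm_nonneg (-1 / 2 + β * u : ℂ)])
    (fun u hu => by
      rw [mem_closedBall_zero_iff]
      nlinarith [hnorm u, hu.1, hu.2, norm_nonneg (-1 / 2 + β * u : ℂ)])
  rw [mul_integral_discIntegrand hp (by linear_combination (-3 / 2 + β) * hβ),
    mul_integral_discIntegrand hp (by linear_combination (-3 / 2 - β) * hβ),
    integral_pow_mul_one_sub_pow_cpow 0 3 three_ne_zero,
    integral_pow_mul_one_sub_pow_cpow 1 3 three_ne_zero,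
    Complex.betaIntegral_eq_Gamma_mul_div _ _ (by norm_num) (by simp; positivity),
    Complex.betaIntegral_eq_Gamma_mul_div _ _ (by norm_num) (by simp; positivity)] at hchord
  refine mul_left_cancel₀ hβ0 (hchord.trans ?_)
  rw [show ((0 : ℕ) + 1 : ℂ) / (3 : ℕ) = 1 / 3 by norm_num,
    show ((1 : ℕ) + 1 : ℂ) / (3 : ℕ) = 2 / 3 by norm_num,
    show (1 / 3 : ℂ) + (p + 1) = p + 4 / 3 by ring,
    show (2 / 3 : ℂ) + (p + 1) = p + 5 / 3 by ring]
  push_cast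
  ring

theorem one_add_mul_cpow_mul_one_sub_sq_cpow {p : ℝ} (hp : 0 < p) {β : ℂ} (hβ : β ^ 2 = -3 / 4)
    {u : ℝ} (hu : u ∈ Set.Icc (-1 : ℝ) 1) :
    (1 + -2 / 3 * β * u) ^ (p + 2 : ℂ) * (1 - (u : ℂ) ^ 2) ^ (p : ℂ) =
      4 / 9 * (8 / 9) ^ (p : ℂ) * discIntegrand p (-1 / 2 + β * u) := by
  have hp0 : (p : ℂ) ≠ 0 := by exact_mod_cast hp.ne'
  have h0 : 0 ≤ 1 - u ^ 2 := by nlinarith [hu.1, hu.2]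
  have hne : 1 + -2 / 3 * β * u ≠ 0 := by
    intro h
    have h1 : ((1 + u ^ 2 / 3 : ℝ) : ℂ) = 0 := by
      push_cast
      linear_combination (1 + 2 / 3 * β * u) * h + 4 / 9 * (u : ℂ) ^ 2 * hβ
    have h2 : 1 + u ^ 2 / 3 = 0 := by exact_mod_cast h1
    nlinarith [sq_nonneg u]
  have hA := ofReal_mul_cpow h0 (1 + -2 / 3 * β * u) hp0
  have hB := ofReal_mul_cpow (by norm_num : (0 : ℝ) ≤ 8 / 9) (1 - (-1 / 2 + β * u) ^ 3) hp0
  have hAB : ((1 - u ^ 2 : ℝ) : ℂ) * (1 + -2 / 3 * β * u) =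
      ((8 / 9 : ℝ) : ℂ) * (1 - (-1 / 2 + β * u) ^ 3) := by
    push_cast
    linear_combination (-4 / 3 * (u : ℂ) ^ 2 + 8 / 9 * (u : ℂ) ^ 3 * β) * hβ
  rw [hAB, hB] at hA
  push_cast at hA
  rw [Complex.cpow_add _ _ hne, discIntegrand, Complex.cpow_ofNat]
  linear_combination -(1 + -2 / 3 * β * u) ^ 2 * hA

theorem tsum_regularizedTerm_of_pos {p : ℝ} (hp : 0 < p) :
    ∑' k, regularizedTerm (p + 2) k = (8 / 9) ^ (p + 1 : ℂ) / (3 * Complex.Gamma (1 / 2)) *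
      (Complex.Gamma (1 / 3) * (Complex.Gamma (p + 4 / 3))⁻¹ +
        2 * Complex.Gamma (2 / 3) * (Complex.Gamma (p + 5 / 3))⁻¹) := by
  obtain ⟨β, hβ⟩ : ∃ β : ℂ, β ^ 2 = -3 / 4 := IsAlgClosed.exists_pow_nat_eq _ two_pos
  have hsum := hasSum_regularizedTerm hp (z := -2 / 3 * β) (by linear_combination 4 / 9 * hβ)
  have hG : Complex.Gamma (1 / 2) ≠ 0 := Complex.Gamma_ne_zero_of_re_pos (by norm_num)
  have hGp : Complex.Gamma (p + 1) ≠ 0 := Complex.Gamma_ne_zero_of_re_pos (by simp; positivity)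
  have h := hsum.tsum_eq
  rw [tsum_mul_left, intervalIntegral.integral_congr (g := fun u : ℝ =>
      4 / 9 * (8 / 9) ^ (p : ℂ) * discIntegrand p (-1 / 2 + β * u)) (fun u hu =>
      one_add_mul_cpow_mul_one_sub_sq_cpow hp hβ (by rwa [Set.uIcc_of_le (by norm_num)] at hu)),
    intervalIntegral.integral_const_mul, integral_discIntegrand_chord hp hβ] at h
  refine mul_left_cancel₀ (mul_ne_zero hG hGp) (h.trans ?_)
  rw [Complex.cpow_add _ _ (by norm_num), Complex.cpow_one]
  field_simp
  ring

/-- Closed form of the regularized series, as an entire function of the parameter. -/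
theorem tsum_regularizedTerm (s : ℂ) :
    ∑' k, regularizedTerm s k = (8 / 9) ^ (s - 1) / (3 * Complex.Gamma (1 / 2)) *
      (Complex.Gamma (1 / 3) * (Complex.Gamma (s - 2 / 3))⁻¹ +
        2 * Complex.Gamma (2 / 3) * (Complex.Gamma (s - 1 / 3))⁻¹) := by
  have h1 : Differentiable ℂ fun s : ℂ => (Complex.Gamma (s - 2 / 3))⁻¹ :=
    Complex.differentiable_one_div_Gamma.comp (by fun_prop : Differentiable ℂ fun s : ℂ => s - 2 / 3)
  have h2 : Differentiable ℂ fun s : ℂ => (Complex.Gamma (s - 1 / 3))⁻¹ :=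
    Complex.differentiable_one_div_Gamma.comp (by fun_prop : Differentiable ℂ fun s : ℂ => s - 1 / 3)
  have h3 : Differentiable ℂ fun s : ℂ => (8 / 9 : ℂ) ^ (s - 1) := fun s =>
    DifferentiableAt.const_cpow (by fun_prop) (Or.inl (by norm_num))
  have hR : Differentiable ℂ fun s : ℂ => (8 / 9 : ℂ) ^ (s - 1) / (3 * Complex.Gamma (1 / 2)) *
      (Complex.Gamma (1 / 3) * (Complex.Gamma (s - 2 / 3))⁻¹ +
        2 * Complex.Gamma (2 / 3) * (Complex.Gamma (s - 1 / 3))⁻¹) :=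
    (h3.div_const _).mul ((h1.const_mul _).add (h2.const_mul _))
  refine congrFun (AnalyticOnNhd.eq_of_frequently_eq (z₀ := (4 : ℂ))
    (fun z _ => differentiable_tsum_regularizedTerm.analyticAt z)
    (fun z _ => hR.analyticAt z) ?_) s
  have ht : Tendsto (fun x : ℝ => (x : ℂ)) (𝓝[>] 4) (𝓝[≠] 4) := by
    refine tendsto_nhdsWithin_iff.mpr ⟨?_, ?_⟩
    · exact (Complex.continuous_ofReal.tendsto' 4 4 (by norm_num)).mono_left nhdsWithin_le_nhds
    · filter_upwards [self_mem_nhdsWithin] with x hx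
      have : x ≠ 4 := ne_of_gt hx
      simp only [Set.mem_compl_iff, Set.mem_singleton_iff]
      exact_mod_cast this
  refine ht.frequently (Eventually.frequently ?_)
  filter_upwards [self_mem_nhdsWithin] with x hx
  have hx4 : (4 : ℝ) < x := hx
  have h := tsum_regularizedTerm_of_pos (p := x - 2) (by linarith)
  push_cast at h
  rw [show (x : ℂ) - 2 + 2 = x by ring, show (x : ℂ) - 2 + 1 = x - 1 by ring,
    show (x : ℂ) - 2 + 4 / 3 = x - 2 / 3 by ring, show (x : ℂ) - 2 + 5 / 3 = x - 1 / 3 by ring] at h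
  exact h

theorem Real.inv_Gamma_eq_self_mul_inv_Gamma_add_one (x : ℝ) :
    (Real.Gamma x)⁻¹ = x * (Real.Gamma (x + 1))⁻¹ := by
  rcases eq_or_ne x 0 with rfl | h
  · simp
  · rw [Real.Gamma_add_one h, mul_inv, mul_inv_cancel_left₀ h]

theorem ofReal_ascPochhammer_eval (k : ℕ) (x : ℝ) :
    (((ascPochhammer ℝ k).eval x : ℝ) : ℂ) = (ascPochhammer ℂ k).eval (x : ℂ) := by
  induction k with
  | zero => simp
  | succ k ih => simp [ascPochhammer_succ_eval, ih]

theorem tsum_ascPochhammer_eq (s : ℝ) (hs : ∀ k : ℕ, s - 1 / 2 ≠ -(k : ℝ)) :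
    ∑' k : ℕ, (ascPochhammer ℝ k).eval (-s / 2) * (ascPochhammer ℝ k).eval (-s / 2 + 1 / 2) /
        ((ascPochhammer ℝ k).eval (s - 1 / 2) * (Nat.factorial k : ℝ)) * (-1 / 3 : ℝ) ^ k =
      Real.Gamma (s - 1 / 2) * ((8 / 9) ^ (s - 1) / (3 * √π) *
        (Real.Gamma (1 / 3) * (Real.Gamma (s - 2 / 3))⁻¹ +
          2 * Real.Gamma (2 / 3) * (Real.Gamma (s - 1 / 3))⁻¹)) := by
  have hs' : ∀ k : ℕ, (s : ℂ) - 1 / 2 ≠ -(k : ℂ) := fun k h =>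
    hs k (Complex.ofReal_injective (by push_cast; exact h))
  have hterm : ∀ k : ℕ, (((ascPochhammer ℝ k).eval (-s / 2) *
      (ascPochhammer ℝ k).eval (-s / 2 + 1 / 2) /
        ((ascPochhammer ℝ k).eval (s - 1 / 2) * (Nat.factorial k : ℝ)) * (-1 / 3 : ℝ) ^ k : ℝ) : ℂ) =
      Complex.Gamma (s - 1 / 2) * regularizedTerm s k := by
    intro k
    push_cast [ofReal_ascPochhammer_eval]
    rw [regularizedTerm, ← Complex.Gamma_add_nat_div_Gamma_eq _ hs']
    simp only [div_eq_mul_inv, mul_inv, inv_inv]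
    ring
  apply Complex.ofReal_injective
  rw [Complex.ofReal_tsum]
  simp only [hterm]
  rw [tsum_mul_left, tsum_regularizedTerm, Complex.Gamma_one_half_eq]
  have hpi : (π : ℂ) ^ (1 / 2 : ℂ) = ((√π : ℝ) : ℂ) := by
    rw [Real.sqrt_eq_rpow, Complex.ofReal_cpow pi_pos.le]; norm_num
  rw [hpi]
  push_cast [Complex.ofReal_cpow (by norm_num : (0 : ℝ) ≤ 8 / 9), ← Complex.Gamma_ofReal]
  rfl

/-- Conversion of the closed form obtained from the integral representation by means of the
duplication and triplication formulas. -/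
theorem Gamma_closed_form_eq (s : ℝ) (hs : 1 - 3 * s ≠ 0) (h2 : ∀ k : ℕ, s + 1 / 3 ≠ -(k : ℝ))
    (h3 : ∀ k : ℕ, s + 2 / 3 ≠ -(k : ℝ)) (h4 : ∀ k : ℕ, 3 * s - 1 ≠ -(k : ℝ)) :
    Real.Gamma (s - 1 / 2) * ((8 / 9) ^ (s - 1) / (3 * √π) *
        (Real.Gamma (1 / 3) * (Real.Gamma (s - 2 / 3))⁻¹ +
          2 * Real.Gamma (2 / 3) * (Real.Gamma (s - 1 / 3))⁻¹)) =
      6 ^ s / 3 * (Real.Gamma (s + 1 / 3) / Real.Gamma (1 / 3) +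
        (1 - 3 * s / 2) / (1 - 3 * s) * (Real.Gamma (s + 2 / 3) / Real.Gamma (2 / 3))) *
        (Real.Gamma (2 * s - 1) / Real.Gamma (3 * s - 1)) := by
  have hG : Real.Gamma s ≠ 0 := Real.Gamma_ne_zero fun k hk => h4 (3 * k + 1) (by
    rw [hk]; push_cast; ring)
  have hA : Real.Gamma (s + 1 / 3) ≠ 0 := Real.Gamma_ne_zero h2
  have hB : Real.Gamma (s + 2 / 3) ≠ 0 := Real.Gamma_ne_zero h3
  have hg1 : Real.Gamma (1 / 3) ≠ 0 := (Real.Gamma_pos_of_pos (by norm_num)).ne'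
  have hg2 : Real.Gamma (2 / 3) ≠ 0 := (Real.Gamma_pos_of_pos (by norm_num)).ne'
  have hpi : √π ≠ 0 := (Real.sqrt_pos.mpr pi_pos).ne'
  have hX : (6 : ℝ) ^ s ≠ 0 := (Real.rpow_pos_of_pos (by norm_num) _).ne'
  have hY : (4 : ℝ) ^ s ≠ 0 := (Real.rpow_pos_of_pos (by norm_num) _).ne'
  have hZ : (27 : ℝ) ^ s ≠ 0 := (Real.rpow_pos_of_pos (by norm_num) _).ne'
  have hdup := Real.Gamma_mul_Gamma_add_half (s - 1 / 2)
  have htri := Gamma_mul_Gamma_add_third_mul_Gamma_add_two_thirds s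
  have e1 : (2 : ℝ) ^ (1 - 2 * (s - 1 / 2)) = 4 / 4 ^ s := by
    rw [show 1 - 2 * (s - 1 / 2) = 2 - 2 * s by ring, Real.rpow_sub two_pos,
      Real.rpow_mul two_pos.le]
    norm_num
  have e2 : (1 / 3 : ℝ) ^ (3 * s) = 1 / 27 ^ s := by
    rw [Real.rpow_mul (by norm_num), one_div ((27 : ℝ) ^ s), ← Real.inv_rpow (by norm_num)]
    norm_num
  have e3 : (8 / 9 : ℝ) ^ (s - 1) = 9 / 8 * (6 ^ s * 4 ^ s / 27 ^ s) := by
    rw [Real.rpow_sub_one (by norm_num), ← Real.mul_rpow (by norm_num) (by norm_num),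
      ← Real.div_rpow (by norm_num) (by norm_num), div_eq_mul_inv, mul_comm]
    norm_num
  rw [e1, show s - 1 / 2 + 1 / 2 = s by ring, show 2 * (s - 1 / 2) = 2 * s - 1 by ring] at hdup
  rw [e2] at htri
  have hT : Real.Gamma (3 * s) ≠ 0 := by
    intro h
    rw [h, zero_mul, zero_mul] at htri
    exact mul_ne_zero (mul_ne_zero hG hA) hB htri
  have hD : Real.Gamma (2 * s - 1) =
      Real.Gamma (s - 1 / 2) * Real.Gamma s * 4 ^ s / (4 * √π) := by
    rw [hdup]; field_simp
  have hTinv : (Real.Gamma (3 * s))⁻¹ = 3 * (Real.Gamma (1 / 3) * Real.Gamma (2 / 3)) /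
      (27 ^ s * (Real.Gamma s * Real.Gamma (s + 1 / 3) * Real.Gamma (s + 2 / 3))) := by
    rw [htri]; field_simp
  rw [Real.inv_Gamma_eq_self_mul_inv_Gamma_add_one (s - 2 / 3),
    Real.inv_Gamma_eq_self_mul_inv_Gamma_add_one (s - 1 / 3),
    div_eq_mul_inv (Real.Gamma (2 * s - 1)),
    Real.inv_Gamma_eq_self_mul_inv_Gamma_add_one (3 * s - 1),
    show s - 2 / 3 + 1 = s + 1 / 3 by ring, show s - 1 / 3 + 1 = s + 2 / 3 by ring,
    show 3 * s - 1 + 1 = 3 * s by ring, hTinv, hD, e3]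
  obtain ⟨q, hq⟩ : ∃ q, q = (1 - 3 * s / 2) / (1 - 3 * s) := ⟨_, rfl⟩
  have hq1 : q * (1 - 3 * s) = 1 - 3 * s / 2 := by rw [hq, div_mul_cancel₀ _ hs]
  rw [← hq]
  generalize Real.Gamma (s + 1 / 3) = A at *
  generalize Real.Gamma (s + 2 / 3) = B at *
  generalize Real.Gamma (s - 1 / 2) = C at *
  field_simp
  linear_combination (72 * C * Real.Gamma (1 / 3) * B) * hq1

theorem gauss_2F1_special_value_d (a : ℝ) (ha : a ≠ -(1 / 6 : ℝ))
    (h1 : ∀ k : ℕ, (-1 / 2 : ℝ) - 2 * a ≠ -(k : ℝ))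
    (h2 : ∀ k : ℕ, (1 / 3 : ℝ) - 2 * a ≠ -(k : ℝ))
    (h3 : ∀ k : ℕ, (2 / 3 : ℝ) - 2 * a ≠ -(k : ℝ))
    (h4 : ∀ k : ℕ, (-1 : ℝ) - 6 * a ≠ -(k : ℝ)) :
    ∑' k : ℕ, (ascPochhammer ℝ k).eval a * (ascPochhammer ℝ k).eval (a + 1 / 2) /
        ((ascPochhammer ℝ k).eval (-1 / 2 - 2 * a) * (Nat.factorial k : ℝ)) *
        (-1 / 3 : ℝ) ^ k
      = (6 : ℝ) ^ (-(2 * a)) / 3 *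
          (Real.Gamma (1 / 3 - 2 * a) / Real.Gamma (1 / 3) +
            (1 + 3 * a) / (1 + 6 * a) * (Real.Gamma (2 / 3 - 2 * a) / Real.Gamma (2 / 3))) *
          (Real.Gamma (-1 - 4 * a) / Real.Gamma (-1 - 6 * a)) := by
  obtain ⟨s, rfl⟩ : ∃ s : ℝ, a = -s / 2 := ⟨-2 * a, by ring⟩
  rw [show (-1 / 2 : ℝ) - 2 * (-s / 2) = s - 1 / 2 by ring] at h1 ⊢
  rw [show (1 / 3 : ℝ) - 2 * (-s / 2) = s + 1 / 3 by ring] at h2 ⊢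
  rw [show (2 / 3 : ℝ) - 2 * (-s / 2) = s + 2 / 3 by ring] at h3 ⊢
  rw [show (-1 : ℝ) - 6 * (-s / 2) = 3 * s - 1 by ring] at h4 ⊢
  rw [show -(2 * (-s / 2)) = s by ring, show 1 + 3 * (-s / 2) = 1 - 3 * s / 2 by ring,
    show 1 + 6 * (-s / 2) = 1 - 3 * s by ring, show -1 - 4 * (-s / 2) = 2 * s - 1 by ring,
    tsum_ascPochhammer_eq s h1]
  exact Gamma_closed_form_eq s (fun h => ha (by linarith)) h2 h3 h4
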